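/- arXiv:1101.1851 — 2 statements merged into one kernel-verified Lean document; each statement's English description precedes it below -/
import Mathlib

section
/- (Multiplicativity of the h-matrices.) For every α ∈ ℤ and all x, y ∈ ℂ, the N×N matrices h(x,α) satisfy h(x,α) · h(y,α) = h(xy,α); explicitly, Σ_{j ∈ ℤ/N} h(x,α)_i^j · h(y,α)_j^k = h(xy,α)_i^k for all i, k ∈ ℤ/N. -/
open Finset

noncomputable def zetaN (N : ℕ) : ℂ := Complex.exp (2 * Real.pi * Complex.I / N)

noncomputable def omegaZ (N : ℕ) (u : ℂ) (n : ℤ) : ℂ :=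
  if 0 ≤ n then ∏ j ∈ range n.toNat, (1 - u * zetaN N ^ (j + 1))
  else (∏ j ∈ range (-n).toNat, (1 - u * zetaN N ^ (-(j : ℤ))))⁻¹

noncomputable def omega2 (N : ℕ) (u v : ℂ) (n : ℤ) : ℂ := v ^ n / omegaZ N u n

noncomputable def omegaStarN (N : ℕ) (u : ℂ) (n : ℕ) : ℂ :=
  ∏ j ∈ range n, (1 - u * zetaN N ^ (-((j : ℤ) + 1)))

noncomputable def gfun (N : ℕ) (x : ℂ) : ℂ :=
  ∏ j ∈ range (N - 1), (1 - x * zetaN N ^ (-((j : ℤ) + 1))) ^ (((j : ℂ) + 1) / (N : ℂ))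

noncomputable def hfun (N : ℕ) (x : ℂ) : ℂ := gfun N x / gfun N 1

noncomputable def brk (N : ℕ) (x : ℂ) : ℂ := (N : ℂ)⁻¹ * ∑ k ∈ range N, x ^ k

noncomputable def ffun (N : ℕ) (x y z : ℂ) : ℂ :=
  ∑ n ∈ range N,
    (∏ j ∈ range (n + 1), (1 - y * zetaN N ^ (j + 1)) / (1 - x * zetaN N ^ (j + 1))) * z ^ (n + 1)

def resN (N : ℕ) (n : ℤ) : ℕ := (n % (N : ℤ)).toNat

noncomputable def hmat (m : ℕ) (x : ℂ) (α : ℤ) (i k : ZMod (2 * m + 1)) : ℂ :=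
  zetaN (2 * m + 1) ^ (α * (((k - i).val : ℤ))) * brk (2 * m + 1) (x * zetaN (2 * m + 1) ^ ((k - i).val))

lemma zeta_pow_val (N : ℕ) [NeZero N] (d : ZMod N) :
    zetaN N ^ d.val = ZMod.stdAddChar d := by
  have h := ZMod.stdAddChar_coe (N := N) (d.val : ℤ)
  have h2 : (((d.val : ℕ) : ℤ) : ZMod N) = d := by simp
  rw [h2] at h
  rw [h, zetaN, ← Complex.exp_nat_mul]
  congr 1
  push_cast
  ring

lemma hmat_eq (m : ℕ) (x : ℂ) (α : ℤ) (i k : ZMod (2 * m + 1)) :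
    hmat m x α i k = (ZMod.stdAddChar (k - i)) ^ α * (((2 * m + 1 : ℕ) : ℂ)⁻¹ *
      ∑ p ∈ range (2 * m + 1), x ^ p * ZMod.stdAddChar ((p : ZMod (2 * m + 1)) * (k - i))) := by
  unfold hmat brk
  rw [mul_comm α, zpow_mul, zpow_natCast, zeta_pow_val]
  congr 2
  refine sum_congr rfl fun p _ => ?_
  rw [mul_pow, ← AddChar.map_nsmul_eq_pow, nsmul_eq_mul]

lemma sum_char (N : ℕ) [NeZero N] (i k : ZMod N) (p q : ℕ) (hp : p < N) (hq : q < N) :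
    ∑ j : ZMod N, (ZMod.stdAddChar ((p : ZMod N) * (j - i)) *
      ZMod.stdAddChar ((q : ZMod N) * (k - j)) : ℂ) =
      if p = q then (N : ℂ) * ZMod.stdAddChar ((p : ZMod N) * (k - i)) else 0 := by
  have h1 : ∀ j : ZMod N, (ZMod.stdAddChar ((p : ZMod N) * (j - i)) *
      ZMod.stdAddChar ((q : ZMod N) * (k - j)) : ℂ) =
      ZMod.stdAddChar ((q : ZMod N) * k - (p : ZMod N) * i) * ZMod.stdAddChar (j * ((p : ZMod N) - (q : ZMod N))) := by
    intro j
    rw [← AddChar.map_add_eq_mul, ← AddChar.map_add_eq_mul]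
    congr 1
    ring
  simp_rw [h1]
  rw [← mul_sum, AddChar.sum_mulShift _ (ZMod.isPrimitive_stdAddChar N)]
  by_cases h : p = q
  · subst h
    rw [← mul_sub, mul_comm]
    simp [ZMod.card]
  · have : (p : ZMod N) - q ≠ 0 := by
      rw [sub_ne_zero]
      intro h'
      rw [ZMod.natCast_eq_natCast_iff'] at h'
      rw [Nat.mod_eq_of_lt hp, Nat.mod_eq_of_lt hq] at h'
      exact h h'
    simp [h, this]

theorem stmt15 (m : ℕ) (hm : 1 ≤ m) (α : ℤ) (x y : ℂ) (i k : ZMod (2 * m + 1)) :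
    ∑ j : ZMod (2 * m + 1), hmat m x α i j * hmat m y α j k = hmat m (x * y) α i k := by
  have hN : ((2 * m + 1 : ℕ) : ℂ) ≠ 0 := Nat.cast_ne_zero.mpr (by omega)
  simp_rw [hmat_eq]
  have h1 : ∀ j : ZMod (2 * m + 1), ∀ A B C : ℂ,
      ((ZMod.stdAddChar (j - i)) ^ α * (C * A)) * ((ZMod.stdAddChar (k - j)) ^ α * (C * B)) =
      ((ZMod.stdAddChar (k - i)) ^ α * C * C) * (A * B) := by
    intro j A B C
    have : (ZMod.stdAddChar (k - i) : ℂ) =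
        ZMod.stdAddChar (j - i) * ZMod.stdAddChar (k - j) := by
      rw [← AddChar.map_add_eq_mul]
      congr 1
      ring
    rw [this, mul_zpow]
    ring
  simp_rw [h1]
  rw [← mul_sum]
  have h2 : ∑ j : ZMod (2 * m + 1),
      (∑ p ∈ range (2 * m + 1), x ^ p * ZMod.stdAddChar ((p : ZMod (2 * m + 1)) * (j - i))) *
      (∑ q ∈ range (2 * m + 1), y ^ q * ZMod.stdAddChar ((q : ZMod (2 * m + 1)) * (k - j))) =
      ((2 * m + 1 : ℕ) : ℂ) * ∑ p ∈ range (2 * m + 1),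
        (x * y) ^ p * ZMod.stdAddChar ((p : ZMod (2 * m + 1)) * (k - i)) := by
    simp_rw [sum_mul_sum]
    rw [sum_comm, mul_sum]
    refine sum_congr rfl fun p hp => ?_
    rw [sum_comm]
    have h3 : ∀ q ∈ range (2 * m + 1), ∑ j : ZMod (2 * m + 1),
        x ^ p * ZMod.stdAddChar ((p : ZMod (2 * m + 1)) * (j - i)) *
        (y ^ q * ZMod.stdAddChar ((q : ZMod (2 * m + 1)) * (k - j))) =
        if p = q then x ^ p * y ^ q * (((2 * m + 1 : ℕ) : ℂ) *
          ZMod.stdAddChar ((p : ZMod (2 * m + 1)) * (k - i))) else 0 := by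
      intro q hq
      simp_rw [mul_mul_mul_comm (x ^ p)]
      rw [← mul_sum, sum_char _ i k p q (mem_range.mp hp) (mem_range.mp hq)]
      split_ifs <;> simp
    rw [sum_congr rfl h3, sum_ite_eq, if_pos hp, mul_pow]
    ring
  rw [h2]
  field_simp
end

section
/- (Symmetry relation for the hypergeometric sum F.) Let x, y, u, v, z, ξ ∈ ℂ satisfy z^N = (1−x^N)(1−u^N)/((1−y^N)(1−v^N)) and ξ^N = (1−x^N)/(1−y^N), with x, v, z, ξ ≠ 0, x^N ≠ 1, u^N ≠ 1, y^N ≠ 1, v^N ≠ 1, (yξ/x)^N ≠ 1 and (ξ/z)^N ≠ 1. Then F(x, u; y, v | z) = N^{−1} · f(x, y | ξ) · f(u, v | z/ξ) · F( yξ/x, ξ/z ; ξ/ζ, uξ/(vzζ) | vζ/x ). -/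
open Finset

noncomputable def Ffun (N : ℕ) (a b c d z : ℂ) : ℂ :=
  ∑ σ ∈ range N,
    (omegaZ N c (σ : ℤ) * omegaZ N d (σ : ℤ) / (omegaZ N a (σ : ℤ) * omegaZ N b (σ : ℤ))) * z ^ σ


lemma prod_one_sub {N : ℕ} (hN : 0 < N) {ζ : ℂ} (hζ : IsPrimitiveRoot ζ N) (x : ℂ) :
    ∏ j ∈ range N, (1 - x * ζ ^ (j + 1)) = 1 - x ^ N := by
  have h := hζ.pow_sub_pow_eq_prod_sub_mul 1 x hN
  rw [one_pow] at h
  rw [h]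
  have : NeZero N := ⟨hN.ne'⟩
  refine Finset.prod_bij (fun j _ => ζ ^ (j + 1)) ?_ ?_ ?_ ?_
  · intro j _
    rw [Polynomial.mem_nthRootsFinset hN, ← pow_mul, mul_comm, pow_mul, hζ.pow_eq_one, one_pow]
  · intro i hi j hj hij
    have h0 : ζ ≠ 0 := hζ.ne_zero hN.ne'
    rw [pow_succ, pow_succ] at hij
    exact hζ.pow_inj (mem_range.1 hi) (mem_range.1 hj) (mul_right_cancel₀ h0 hij)
  · intro b hb
    rw [Polynomial.mem_nthRootsFinset hN] at hb
    have h0 : ζ ≠ 0 := hζ.ne_zero hN.ne'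
    obtain ⟨i, hi, h⟩ := hζ.eq_pow_of_pow_eq_one (ξ := b * ζ⁻¹)
      (by rw [mul_pow, hb, inv_pow, hζ.pow_eq_one]; simp)
    exact ⟨i, mem_range.2 hi, by rw [pow_succ, h]; field_simp⟩
  · intro j _
    ring

lemma one_sub_ne {N : ℕ} {ζ : ℂ} (hζ : ζ ^ N = 1) {x : ℂ} (hx : x ^ N ≠ 1) (j : ℕ) :
    1 - x * ζ ^ j ≠ 0 := by
  intro h
  apply hx
  have : (x * ζ ^ j) ^ N = 1 := by rw [← sub_eq_zero.1 h, one_pow]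
  rwa [mul_pow, ← pow_mul, mul_comm j, pow_mul, hζ, one_pow, mul_one] at this

/-- product of ratios -/
noncomputable def wr (ζ x y : ℂ) (n : ℕ) : ℂ :=
  ∏ j ∈ range n, (1 - y * ζ ^ (j + 1)) / (1 - x * ζ ^ (j + 1))

/-- cyclic sum -/
noncomputable def Sr (N : ℕ) (ζ x y z : ℂ) : ℂ := ∑ n ∈ range N, wr ζ x y n * z ^ n

lemma wr_N {N : ℕ} (hN : 0 < N) {ζ : ℂ} (hζ : IsPrimitiveRoot ζ N) {x y z : ℂ}
    (hx : x ^ N ≠ 1) (hy : y ^ N ≠ 1) (hz : z ^ N = (1 - x ^ N) / (1 - y ^ N)) :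
    wr ζ x y N * z ^ N = 1 := by
  rw [wr, prod_div_distrib, prod_one_sub hN hζ, prod_one_sub hN hζ, hz]
  have h1 : 1 - x ^ N ≠ 0 := fun h => hx (sub_eq_zero.1 h).symm
  have h2 : 1 - y ^ N ≠ 0 := fun h => hy (sub_eq_zero.1 h).symm
  field_simp

lemma Sr_shift {N : ℕ} {ζ x y z : ℂ} (h : wr ζ x y N * z ^ N = 1) :
    ∑ n ∈ range N, wr ζ x y (n + 1) * z ^ (n + 1) = Sr N ζ x y z := by
  have h1 := sum_range_succ (fun n => wr ζ x y n * z ^ n) N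
  have h2 := sum_range_succ' (fun n => wr ζ x y n * z ^ n) N
  have h0 : wr ζ x y 0 * z ^ 0 = 1 := by simp [wr]
  rw [h1] at h2
  rw [h, h0] at h2
  exact (add_right_cancel h2).symm

lemma Sr_rec {N : ℕ} (hN : 0 < N) {ζ : ℂ} (hζ : IsPrimitiveRoot ζ N) {x y z : ℂ}
    (hx : x ^ N ≠ 1) (hy : y ^ N ≠ 1) (hz : z ^ N = (1 - x ^ N) / (1 - y ^ N)) :
    Sr N ζ x y z * (1 - z) = Sr N ζ x y (z * ζ) * (x - y * z * ζ) := by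
  have e1 := wr_N hN hζ hx hy hz
  have e2 : wr ζ x y N * (z * ζ) ^ N = 1 := by rw [mul_pow, hζ.pow_eq_one, mul_one, e1]
  have key : ∑ n ∈ range N, wr ζ x y (n + 1) * z ^ (n + 1)
      - x * ∑ n ∈ range N, wr ζ x y (n + 1) * (z * ζ) ^ (n + 1)
      = z * Sr N ζ x y z - y * z * ζ * Sr N ζ x y (z * ζ) := by
    simp only [Sr, mul_sum, ← sum_sub_distrib]
    refine sum_congr rfl fun n _ => ?_
    have hne := one_sub_ne hζ.pow_eq_one hx (n + 1)
    have : wr ζ x y (n + 1) * (1 - x * ζ ^ (n + 1)) = wr ζ x y n * (1 - y * ζ ^ (n + 1)) := by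
      rw [wr, prod_range_succ, ← wr, mul_assoc, div_mul_cancel₀ _ hne]
    rw [mul_pow, mul_pow]
    linear_combination z ^ (n + 1) * this
  rw [Sr_shift e1, Sr_shift e2] at key
  linear_combination key

lemma omega_nat (N : ℕ) (u : ℂ) (n : ℕ) :
    omegaZ N u (n : ℤ) = ∏ j ∈ range n, (1 - u * zetaN N ^ (j + 1)) := by
  simp [omegaZ]

lemma orth {N : ℕ} (hN : 0 < N) {ζ : ℂ} (hζ : IsPrimitiveRoot ζ N) (n m : ℕ)
    (hn : n < N) (hm : m < N) :
    ∑ k ∈ range N, (ζ ^ k) ^ n * ((ζ⁻¹) ^ k) ^ m = if n = m then (N : ℂ) else 0 := by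
  have h0 : ζ ≠ 0 := hζ.ne_zero hN.ne'
  have e : ∀ k, (ζ ^ k) ^ n * ((ζ⁻¹) ^ k) ^ m = (ζ ^ n * (ζ⁻¹) ^ m) ^ k := by
    intro k; rw [mul_pow, ← pow_mul, ← pow_mul, ← pow_mul, ← pow_mul, mul_comm k, mul_comm k]
  simp only [e]
  split_ifs with h
  · subst h
    rw [← mul_pow, mul_inv_cancel₀ h0]; simp
  · have hne : ζ ^ n * (ζ⁻¹) ^ m ≠ 1 := by
      intro h'
      apply h
      apply hζ.pow_inj hn hm
      rw [inv_pow] at h'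
      exact (mul_inv_eq_one₀ (pow_ne_zero _ h0)).1 h'
    rw [geom_sum_eq hne, ← e, hζ.pow_eq_one, inv_pow, hζ.pow_eq_one]
    simp

lemma parseval {N : ℕ} (hN : 0 < N) {ζ : ℂ} (hζ : IsPrimitiveRoot ζ N) (x y u v a b : ℂ) :
    ∑ k ∈ range N, Sr N ζ x y (a * ζ ^ k) * Sr N ζ u v (b * (ζ⁻¹) ^ k)
      = N * ∑ n ∈ range N, wr ζ x y n * wr ζ u v n * (a * b) ^ n := by
  simp only [Sr, sum_mul_sum]
  rw [sum_comm, mul_sum]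
  refine sum_congr rfl fun n hn => ?_
  rw [sum_comm]
  have : ∀ m ∈ range N, ∑ k ∈ range N, wr ζ x y n * (a * ζ ^ k) ^ n *
      (wr ζ u v m * (b * (ζ⁻¹) ^ k) ^ m)
      = if n = m then (N : ℂ) * (wr ζ x y n * wr ζ u v m * (a ^ n * b ^ m)) else 0 := by
    intro m hm
    have h := orth hN hζ n m (mem_range.1 hn) (mem_range.1 hm)
    calc _ = (wr ζ x y n * wr ζ u v m * (a ^ n * b ^ m)) *
          ∑ k ∈ range N, (ζ ^ k) ^ n * ((ζ⁻¹) ^ k) ^ m := by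
          rw [mul_sum]; refine sum_congr rfl fun k _ => ?_
          rw [mul_pow, mul_pow]; ring
      _ = _ := by rw [h]; split_ifs <;> ring
  rw [sum_congr rfl this, sum_ite_eq, if_pos hn, mul_pow]

theorem stmt18 (m N : ℕ) (hm : 1 ≤ m) (hN : N = 2 * m + 1)
    (x y u v z ξ : ℂ)
    (hz : z ^ N = (1 - x ^ N) * (1 - u ^ N) / ((1 - y ^ N) * (1 - v ^ N)))
    (hξ : ξ ^ N = (1 - x ^ N) / (1 - y ^ N))
    (hx0 : x ≠ 0) (hv0 : v ≠ 0) (hz0 : z ≠ 0) (hξ0 : ξ ≠ 0)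
    (hx : x ^ N ≠ 1) (hu : u ^ N ≠ 1) (hy : y ^ N ≠ 1) (hv : v ^ N ≠ 1)
    (h1 : (y * ξ / x) ^ N ≠ 1) (h2 : (ξ / z) ^ N ≠ 1) :
    Ffun N x u y v z
      = (N : ℂ)⁻¹ * ffun N x y ξ * ffun N u v (z / ξ) *
          Ffun N (y * ξ / x) (ξ / z) (ξ / zetaN N) (u * ξ / (v * z * zetaN N)) (v * zetaN N / x) := by
  have hN0 : 0 < N := by omega
  have hζ : IsPrimitiveRoot (zetaN N) N := Complex.isPrimitiveRoot_exp N hN0.ne'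
  have hff : ∀ {x y z : ℂ}, x ^ N ≠ 1 → y ^ N ≠ 1 → z ^ N = (1 - x ^ N) / (1 - y ^ N) →
      ffun N x y z = Sr N (zetaN N) x y z := by
    intro x y z hx hy hz
    rw [← Sr_shift (wr_N hN0 hζ hx hy hz)]
    rfl
  set w := z / ξ with hw
  have hw0 : w ≠ 0 := div_ne_zero hz0 hξ0
  have hzw : z = ξ * w := by rw [hw]; field_simp
  have n1 : 1 - x ^ N ≠ 0 := fun h => hx (sub_eq_zero.1 h).symm
  have n2 : 1 - y ^ N ≠ 0 := fun h => hy (sub_eq_zero.1 h).symm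
  have n3 : 1 - v ^ N ≠ 0 := fun h => hv (sub_eq_zero.1 h).symm
  have hwN : w ^ N = (1 - u ^ N) / (1 - v ^ N) := by
    rw [hw, div_pow, hz, hξ]; field_simp
  rw [hff hx hy hξ, hff hu hv hwN]
  have hP := parseval hN0 hζ x y u v ξ w
  simp only [Ffun, omega_nat]
  generalize zetaN N = ζ at *
  have h0 : ζ ≠ 0 := hζ.ne_zero hN0.ne'
  have hb : ξ / z = w⁻¹ := by rw [hw, inv_div]
  rw [hb] at h2 ⊢
  have A : ∀ k : ℕ, Sr N ζ x y (ξ * ζ ^ k) = Sr N ζ x y ξ *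
      ((∏ j ∈ range k, (1 - ξ / ζ * ζ ^ (j + 1))) /
        (∏ j ∈ range k, (1 - y * ξ / x * ζ ^ (j + 1)))) * (x⁻¹) ^ k := by
    intro k
    induction k with
    | zero => simp
    | succ k ih =>
      have r := Sr_rec hN0 hζ (z := ξ * ζ ^ k) hx hy
        (by rw [mul_pow, ← pow_mul, mul_comm k, pow_mul, hζ.pow_eq_one, one_pow, mul_one, hξ])
      have hne := one_sub_ne hζ.pow_eq_one h1 (k + 1)
      have hD : (∏ j ∈ range k, (1 - y * ξ / x * ζ ^ (j + 1))) ≠ 0 :=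
        prod_ne_zero_iff.2 fun j _ => one_sub_ne hζ.pow_eq_one h1 (j + 1)
      have e1 : x - y * (ξ * ζ ^ k) * ζ = x * (1 - y * ξ / x * ζ ^ (k + 1)) := by
        field_simp; ring
      have e2 : 1 - ξ / ζ * ζ ^ (k + 1) = 1 - ξ * ζ ^ k := by
        rw [pow_succ]; field_simp
      have e3 : ξ * ζ ^ (k + 1) = ξ * ζ ^ k * ζ := by ring
      rw [e1, ih] at r
      rw [prod_range_succ, prod_range_succ, e2, e3, eq_div_of_mul_eq (mul_ne_zero hx0 hne) r.symm]
      generalize (1 - y * ξ / x * ζ ^ (k + 1)) = D at *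
      rw [pow_succ]
      field_simp
  have B : ∀ k : ℕ, Sr N ζ u v (w * (ζ⁻¹) ^ k) = Sr N ζ u v w *
      ((∏ j ∈ range k, (1 - u * ξ / (v * z * ζ) * ζ ^ (j + 1))) /
        (∏ j ∈ range k, (1 - w⁻¹ * ζ ^ (j + 1)))) * (v * ζ) ^ k := by
    intro k
    induction k with
    | zero => simp
    | succ k ih =>
      have r := Sr_rec hN0 hζ (z := w * (ζ⁻¹) ^ (k + 1)) hu hv
        (by rw [mul_pow, ← pow_mul, mul_comm (k + 1), pow_mul, inv_pow, hζ.pow_eq_one, inv_one,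
              one_pow, mul_one, hwN])
      have hne := one_sub_ne hζ.pow_eq_one h2 (k + 1)
      have hD : (∏ j ∈ range k, (1 - w⁻¹ * ζ ^ (j + 1))) ≠ 0 :=
        prod_ne_zero_iff.2 fun j _ => one_sub_ne hζ.pow_eq_one h2 (j + 1)
      have e0 : w * (ζ⁻¹) ^ (k + 1) * ζ = w * (ζ⁻¹) ^ k := by
        rw [pow_succ]; field_simp
      have e1 : 1 - w * (ζ⁻¹) ^ (k + 1) =
          -(w * (ζ⁻¹) ^ (k + 1)) * (1 - w⁻¹ * ζ ^ (k + 1)) := by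
        rw [inv_pow]; field_simp; ring
      have e2 : u - v * (w * (ζ⁻¹) ^ (k + 1)) * ζ = -(w * (ζ⁻¹) ^ (k + 1)) * ((v * ζ) *
          (1 - u * ξ / (v * z * ζ) * ζ ^ (k + 1))) := by
        rw [inv_pow, hzw]; field_simp; ring
      have hc : -(w * (ζ⁻¹) ^ (k + 1)) ≠ 0 :=
        neg_ne_zero.2 (mul_ne_zero hw0 (pow_ne_zero _ (inv_ne_zero h0)))
      rw [e0, e1, e2, ih, mul_left_comm, mul_left_comm _ (-(w * (ζ⁻¹) ^ (k + 1)))] at r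
      have r := mul_left_cancel₀ hc r
      rw [prod_range_succ, prod_range_succ, eq_div_of_mul_eq hne r]
      generalize (1 - w⁻¹ * ζ ^ (k + 1)) = D at *
      generalize (1 - u * ξ / (v * z * ζ) * ζ ^ (k + 1)) = E at *
      rw [pow_succ]
      field_simp
  have hNc : (N : ℂ) ≠ 0 := Nat.cast_ne_zero.2 hN0.ne'
  have L : ∑ n ∈ range N, wr ζ x y n * wr ζ u v n * (ξ * w) ^ n =
      (N : ℂ)⁻¹ * ∑ k ∈ range N, Sr N ζ x y (ξ * ζ ^ k) * Sr N ζ u v (w * (ζ⁻¹) ^ k) := by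
    rw [hP, inv_mul_cancel_left₀ hNc]
  calc _ = ∑ n ∈ range N, wr ζ x y n * wr ζ u v n * (ξ * w) ^ n := by
        refine sum_congr rfl fun n _ => ?_
        rw [← hzw, wr, wr, prod_div_distrib, prod_div_distrib, div_mul_div_comm]
    _ = _ := by
        rw [L, mul_assoc, mul_assoc]
        congr 1
        rw [mul_sum, mul_sum]
        refine sum_congr rfl fun k _ => ?_
        rw [A, B, ← div_mul_div_comm, div_eq_mul_inv (v * ζ) x, mul_pow (v * ζ)]
        ring
end
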